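/- Let n ≥ 1, ε > 0, and let f : B(0,ε) × [0,1] → ℝ, where B(0,ε) ⊂ ℝⁿ is the open ball of radius ε around 0, satisfy f(0,t) = 0 for all t. Assume there exist an open set V ⊂ ℝⁿ × ℝ × ℝ containing Sⁿ⁻¹ × [0,ε) × [0,1] (Sⁿ⁻¹ the unit sphere of ℝⁿ) and a C^∞ function G : V → ℝ such that f(rξ, t) = G(ξ, r, t) for every ξ ∈ Sⁿ⁻¹, r ∈ [0,ε), t ∈ [0,1]. Assume further that for each t ∈ [0,1] the degree-1 homogeneous function v ↦ |v|·(∂G/∂r)(v/|v|, 0, t) (for v ≠ 0), extended by 0 at v = 0, is an ℝ-linear map ℝⁿ → ℝ. Then there exist δ ∈ (0,ε) and C > 0 such that for every t ∈ [0,1] the function x ↦ f(x,t) is differentiable at every point of B(0,δ) and its derivative map x ↦ D_x f(·,t) ∈ (ℝⁿ)* is Lipschitz on B(0,δ) with Lipschitz constant at most C. -/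

import Mathlib

open Set Filter Topology

/-- Second-order Taylor estimate in the middle variable, uniform over a compact set of
parameters. -/
theorem exists_norm_sub_sub_smul_le_sq {E F : Type*} [NormedAddCommGroup E] [NormedSpace ℝ E]
    [NormedAddCommGroup F] [NormedSpace ℝ F] {W : Set (E × ℝ × ℝ)} (hW : IsOpen W)
    {Φ : E × ℝ × ℝ → F} (hΦ : ContDiffOn ℝ (⊤ : ℕ∞) Φ W) {S : Set E} (hS : IsCompact S) {δ : ℝ}
    {T : Set ℝ} (hT : IsCompact T) (hSW : S ×ˢ Icc 0 δ ×ˢ T ⊆ W) :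
    ∃ C : ℝ, 0 ≤ C ∧ ∀ u ∈ S, ∀ s ∈ Icc 0 δ, ∀ t ∈ T,
      ‖Φ (u, s, t) - Φ (u, 0, t) - s • fderiv ℝ Φ (u, 0, t) (0, 1, 0)‖ ≤ C * s ^ 2 := by
  set Ψ : E × ℝ × ℝ → F := fun p => fderiv ℝ Φ p (0, 1, 0) with hΨdef
  have hΨ : ContDiffOn ℝ (⊤ : ℕ∞) Ψ W :=
    (hΦ.fderiv_of_isOpen hW (m := (⊤ : ℕ∞)) le_rfl).clm_apply contDiffOn_const
  have hΨ' : ContDiffOn ℝ (⊤ : ℕ∞) (fun p => fderiv ℝ Ψ p (0, 1, 0)) W :=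
    (hΨ.fderiv_of_isOpen hW (m := (⊤ : ℕ∞)) le_rfl).clm_apply contDiffOn_const
  obtain ⟨C, hC⟩ := (hS.prod (isCompact_Icc.prod hT)).exists_bound_of_continuousOn
    (hΨ'.continuousOn.mono hSW)
  have hline : ∀ (u : E) (t s : ℝ),
      HasDerivAt (fun s : ℝ => (u, s, t)) ((0 : E), (1 : ℝ), (0 : ℝ)) s :=
    fun u t s => (hasDerivAt_const s u).prodMk ((hasDerivAt_id s).prodMk (hasDerivAt_const s t))
  refine ⟨max C 0, le_max_right _ _, fun u hu s hs t ht => ?_⟩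
  have hmem : ∀ r ∈ Icc 0 s, (u, r, t) ∈ S ×ˢ Icc 0 δ ×ˢ T := fun r hr =>
    ⟨hu, ⟨hr.1, hr.2.trans hs.2⟩, ht⟩
  have hΦd : ∀ r ∈ Icc 0 s, HasDerivAt (fun r => Φ (u, r, t)) (Ψ (u, r, t)) r := fun r hr => by
    have hd : DifferentiableAt ℝ Φ (u, r, t) :=
      (hΦ.contDiffAt (hW.mem_nhds (hSW (hmem r hr)))).differentiableAt (by simp)
    exact hd.hasFDerivAt.comp_hasDerivAt r (hline u t r)
  have hΨd : ∀ r ∈ Icc 0 s, HasDerivAt (fun r => Ψ (u, r, t))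
      (fderiv ℝ Ψ (u, r, t) (0, 1, 0)) r := fun r hr => by
    have hd : DifferentiableAt ℝ Ψ (u, r, t) :=
      (hΨ.contDiffAt (hW.mem_nhds (hSW (hmem r hr)))).differentiableAt (by simp)
    exact hd.hasFDerivAt.comp_hasDerivAt r (hline u t r)
  have h0 : (0 : ℝ) ∈ Icc 0 s := ⟨le_rfl, hs.1⟩
  have hs' : s ∈ Icc 0 s := ⟨hs.1, le_rfl⟩
  have hΨle : ∀ r ∈ Icc 0 s, ‖Ψ (u, r, t) - Ψ (u, 0, t)‖ ≤ max C 0 * s := by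
    intro r hr
    have := (convex_Icc (0 : ℝ) s).norm_image_sub_le_of_norm_hasDerivWithin_le
      (fun r hr => (hΨd r hr).hasDerivWithinAt)
      (fun r hr => (hC _ (hmem r hr)).trans (le_max_left C 0)) h0 hr
    refine this.trans ?_
    rw [sub_zero, Real.norm_eq_abs, abs_of_nonneg hr.1]
    exact mul_le_mul_of_nonneg_left hr.2 (le_max_right _ _)
  have := (convex_Icc (0 : ℝ) s).norm_image_sub_le_of_norm_hasDerivWithin_le
    (f := fun r => Φ (u, r, t) - r • Ψ (u, 0, t)) (f' := fun r => Ψ (u, r, t) - Ψ (u, 0, t))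
    (fun r hr => by
      have h := (hΦd r hr).sub ((hasDerivAt_id r).smul_const (Ψ (u, 0, t)))
      rw [one_smul] at h
      exact h.hasDerivWithinAt)
    hΨle h0 hs'
  rw [sub_zero, Real.norm_eq_abs, abs_of_nonneg hs.1] at this
  convert this using 1
  · congr 1
    simp only [hΨdef, zero_smul, sub_zero]
    abel
  · ring

/-- The derivative of `Φ : E × ℝ × ℝ → F` in its first variable. -/
noncomputable def fderivFst {E F : Type*} [NormedAddCommGroup E] [NormedSpace ℝ E]
    [NormedAddCommGroup F] [NormedSpace ℝ F] (Φ : E × ℝ × ℝ → F) (p : E × ℝ × ℝ) : E →L[ℝ] F :=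
  (fderiv ℝ Φ p).comp (ContinuousLinearMap.inl ℝ E (ℝ × ℝ))

section fderivFst

variable {E F : Type*} [NormedAddCommGroup E] [NormedSpace ℝ E]
  [NormedAddCommGroup F] [NormedSpace ℝ F] {W : Set (E × ℝ × ℝ)} {Φ : E × ℝ × ℝ → F}

theorem contDiffOn_fderivFst (hW : IsOpen W) (hΦ : ContDiffOn ℝ (⊤ : ℕ∞) Φ W) :
    ContDiffOn ℝ (⊤ : ℕ∞) (fderivFst Φ) W :=
  (hΦ.fderiv_of_isOpen hW (m := (⊤ : ℕ∞)) le_rfl).clm_comp contDiffOn_const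

theorem hasFDerivAt_fderivFst {u : E} {s t : ℝ} (hW : IsOpen W)
    (hΦ : ContDiffOn ℝ (⊤ : ℕ∞) Φ W) (hp : (u, s, t) ∈ W) :
    HasFDerivAt (fun v => Φ (v, s, t)) (fderivFst Φ (u, s, t)) u :=
  ((hΦ.contDiffAt (hW.mem_nhds hp)).differentiableAt (by simp)).hasFDerivAt.comp u
    (hasFDerivAt_prodMk_left u (s, t))

/-- Mixed partial derivatives commute: the radial derivative of the derivative in the first
variable is the derivative of the radial derivative. -/
theorem fderiv_fderivFst_apply {u : E} {s t : ℝ} (hW : IsOpen W)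
    (hΦ : ContDiffOn ℝ (⊤ : ℕ∞) Φ W) (hp : (u, s, t) ∈ W) {g : E → F} {L : E →L[ℝ] F}
    (hg : (fun v => fderiv ℝ Φ (v, s, t) (0, 1, 0)) =ᶠ[𝓝 u] g) (hL : HasFDerivAt g L u) :
    fderiv ℝ (fderivFst Φ) (u, s, t) (0, 1, 0) = L := by
  have hΦp : ContDiffAt ℝ (⊤ : ℕ∞) Φ (u, s, t) := hΦ.contDiffAt (hW.mem_nhds hp)
  have hd : DifferentiableAt ℝ (fderiv ℝ Φ) (u, s, t) :=
    (hΦp.fderiv_right (m := (⊤ : ℕ∞)) le_rfl).differentiableAt (by simp)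
  have hsymm : IsSymmSndFDerivAt ℝ Φ (u, s, t) :=
    hΦp.isSymmSndFDerivAt (by simpa using WithTop.coe_le_coe.2 (le_top : (2 : ℕ∞) ≤ ⊤))
  have h1 : HasFDerivAt (fun v => fderiv ℝ Φ (v, s, t) (0, 1, 0)) L u :=
    hL.congr_of_eventuallyEq hg
  have hcomp : HasFDerivAt (fun v => fderiv ℝ Φ (v, s, t)) _ u :=
    hd.hasFDerivAt.comp u (hasFDerivAt_prodMk_left u (s, t))
  have h2 := hcomp.clm_apply (hasFDerivAt_const ((0 : E), (1 : ℝ), (0 : ℝ)) u)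
  have h3 := hd.hasFDerivAt.clm_comp
    (hasFDerivAt_const (ContinuousLinearMap.inl ℝ E (ℝ × ℝ)) (u, s, t))
  have h4 : fderiv ℝ (fderivFst Φ) (u, s, t) = _ := h3.fderiv
  rw [h4, h1.unique h2]
  ext w
  simpa [Prod.zero_eq_mk] using hsymm (0, 1, 0) (w, 0, 0)

end fderivFst

/-- A function whose derivative is bounded by `C` away from the centre of a ball, and which
satisfies the Lipschitz estimate based at the centre, is `C`-Lipschitz on the ball. -/
theorem norm_sub_le_of_norm_fderiv_le_off_zero {E F : Type*} [NormedAddCommGroup E]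
    [NormedSpace ℝ E] [NormedAddCommGroup F] [NormedSpace ℝ F] {g : E → F} {δ C : ℝ}
    (hd : ∀ x ∈ Metric.ball (0 : E) δ, x ≠ 0 → DifferentiableAt ℝ g x)
    (hC : ∀ x ∈ Metric.ball (0 : E) δ, x ≠ 0 → ‖fderiv ℝ g x‖ ≤ C)
    (h0 : ∀ x ∈ Metric.ball (0 : E) δ, ‖g x - g 0‖ ≤ C * ‖x‖)
    {x y : E} (hx : x ∈ Metric.ball (0 : E) δ) (hy : y ∈ Metric.ball (0 : E) δ) :
    ‖g x - g y‖ ≤ C * ‖x - y‖ := by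
  by_cases hxy : (0 : E) ∈ segment ℝ x y
  · have hdist : ‖x‖ + ‖y‖ = ‖x - y‖ := by
      simpa [dist_eq_norm] using dist_add_dist_of_mem_segment hxy
    calc ‖g x - g y‖ = ‖(g x - g 0) - (g y - g 0)‖ := by congr 1; abel
      _ ≤ ‖g x - g 0‖ + ‖g y - g 0‖ := norm_sub_le _ _
      _ ≤ C * ‖x‖ + C * ‖y‖ := add_le_add (h0 x hx) (h0 y hy)
      _ = C * ‖x - y‖ := by rw [← hdist]; ring
  · have hsub : segment ℝ x y ⊆ Metric.ball 0 δ := (convex_ball 0 δ).segment_subset hx hy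
    have hne : ∀ z ∈ segment ℝ x y, z ≠ 0 := fun z hz h => hxy (h ▸ hz)
    exact (convex_segment x y).norm_image_sub_le_of_norm_fderiv_le
      (fun z hz => hd z (hsub hz) (hne z hz)) (fun z hz => hC z (hsub hz) (hne z hz))
      (right_mem_segment ℝ x y) (left_mem_segment ℝ x y)

/-- A real function whose rescalings `u ↦ f (s • u)` agree with `K s` near the unit sphere is
`C^{1,1}` near the origin, provided `K s` is `s • L` up to `O(s²)` in `C²`. -/
theorem contDiff_one_one_of_rescaling {E : Type*} [NormedAddCommGroup E] [NormedSpace ℝ E]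
    {f : E → ℝ} {δ C : ℝ} (hδ : 0 < δ) (hf0 : f 0 = 0) (L : E →L[ℝ] ℝ)
    {K : ℝ → E → ℝ} {A : ℝ → E → E →L[ℝ] ℝ} {B : ℝ → E → E →L[ℝ] E →L[ℝ] ℝ}
    (hfK : ∀ s, 0 < s → s < δ → ∀ u, ‖u‖ = 1 → ∀ᶠ v in 𝓝 u, f (s • v) = K s v)
    (hA : ∀ s, 0 < s → s < δ → ∀ u, ‖u‖ = 1 → ∀ᶠ v in 𝓝 u, HasFDerivAt (K s) (A s v) v)
    (hB : ∀ s, 0 < s → s < δ → ∀ u, ‖u‖ = 1 → HasFDerivAt (A s) (B s u) u)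
    (hKle : ∀ s, 0 < s → s < δ → ∀ u, ‖u‖ = 1 → ‖K s u - s * L u‖ ≤ C * s ^ 2)
    (hAle : ∀ s, 0 < s → s < δ → ∀ u, ‖u‖ = 1 → ‖A s u - s • L‖ ≤ C * s ^ 2)
    (hBle : ∀ s, 0 < s → s < δ → ∀ u, ‖u‖ = 1 → ‖B s u‖ ≤ C * s ^ 2) :
    (∀ x ∈ Metric.ball (0 : E) δ, DifferentiableAt ℝ f x) ∧
      ∀ x ∈ Metric.ball (0 : E) δ, ∀ y ∈ Metric.ball (0 : E) δ,
        ‖fderiv ℝ f x - fderiv ℝ f y‖ ≤ C * ‖x - y‖ := by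
  have hscale : ∀ (s : ℝ) (y : E), HasFDerivAt (fun y : E => s⁻¹ • y)
      (s⁻¹ • ContinuousLinearMap.id ℝ E) y := fun s y => (hasFDerivAt_id y).const_smul s⁻¹
  have hunit : ∀ x : E, x ≠ 0 → ‖‖x‖⁻¹ • x‖ = 1 := fun x hx => by
    simp [norm_smul, hx]
  -- `f y = K ‖x‖ (‖x‖⁻¹ • y)` for `y` near `x`, and similarly for the derivatives
  have hf : ∀ x ∈ Metric.ball (0 : E) δ, x ≠ 0 →
      ∀ᶠ y in 𝓝 x, HasFDerivAt f (‖x‖⁻¹ • A ‖x‖ (‖x‖⁻¹ • y)) y := by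
    intro x hx hx0
    have hs : 0 < ‖x‖ := norm_pos_iff.2 hx0
    have hsδ : ‖x‖ < δ := by simpa using hx
    have hcont : Tendsto (fun y : E => ‖x‖⁻¹ • y) (𝓝 x) (𝓝 (‖x‖⁻¹ • x)) :=
      (hscale ‖x‖ x).continuousAt
    have h1 := (hcont.eventually (hfK _ hs hsδ _ (hunit x hx0))).eventually_nhds
    filter_upwards [h1, hcont.eventually (hA _ hs hsδ _ (hunit x hx0))] with y hy hAy
    have hEq : f =ᶠ[𝓝 y] fun z => K ‖x‖ (‖x‖⁻¹ • z) := by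
      filter_upwards [hy] with z hz
      rw [← hz, smul_inv_smul₀ hs.ne']
    have := (hAy.comp y (hscale ‖x‖ y)).congr_of_eventuallyEq hEq
    simpa using this
  have hf' : ∀ x ∈ Metric.ball (0 : E) δ, x ≠ 0 →
      HasFDerivAt (fderiv ℝ f) ((‖x‖ ^ 2)⁻¹ • B ‖x‖ (‖x‖⁻¹ • x)) x := by
    intro x hx hx0
    have hs : 0 < ‖x‖ := norm_pos_iff.2 hx0
    have hsδ : ‖x‖ < δ := by simpa using hx
    have hEq : fderiv ℝ f =ᶠ[𝓝 x] fun y => ‖x‖⁻¹ • A ‖x‖ (‖x‖⁻¹ • y) := by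
      filter_upwards [hf x hx hx0] with y hy using hy.fderiv
    have := (((hB _ hs hsδ _ (hunit x hx0)).comp x (hscale ‖x‖ x)).const_smul
      ‖x‖⁻¹).congr_of_eventuallyEq hEq
    have hmap : (‖x‖ ^ 2)⁻¹ • B ‖x‖ (‖x‖⁻¹ • x) = ‖x‖⁻¹ • (B ‖x‖ (‖x‖⁻¹ • x)).comp
        (‖x‖⁻¹ • ContinuousLinearMap.id ℝ E) := by
      ext v w
      simp [pow_two, mul_assoc]
    rwa [hmap]
  have hzero : HasFDerivAt f L 0 := by
    have hO : (fun x : E => f x - L x) =O[𝓝 0] fun x => ‖x‖ ^ 2 := by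
      refine Asymptotics.IsBigO.of_bound C ?_
      filter_upwards [Metric.ball_mem_nhds (0 : E) hδ] with x hx
      by_cases hx0 : x = 0
      · simp [hx0, hf0]
      have hs : 0 < ‖x‖ := norm_pos_iff.2 hx0
      have hsδ : ‖x‖ < δ := by simpa using hx
      have h1 := hKle _ hs hsδ _ (hunit x hx0)
      rw [← (hfK _ hs hsδ _ (hunit x hx0)).self_of_nhds, smul_inv_smul₀ hs.ne', map_smul,
        smul_eq_mul, mul_inv_cancel_left₀ hs.ne'] at h1
      simpa using h1
    rw [hasFDerivAt_iff_isLittleO_nhds_zero]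
    simpa [hf0] using hO.trans_isLittleO (Asymptotics.isLittleO_norm_pow_id one_lt_two)
  refine ⟨fun x hx => ?_, fun x hx y hy => norm_sub_le_of_norm_fderiv_le_off_zero
    (fun x hx hx0 => (hf' x hx hx0).differentiableAt) (fun x hx hx0 => ?_) (fun x hx => ?_) hx hy⟩
  · by_cases hx0 : x = 0
    · exact hx0 ▸ hzero.differentiableAt
    · exact (hf x hx hx0).self_of_nhds.differentiableAt
  · have hs : 0 < ‖x‖ := norm_pos_iff.2 hx0
    have hsδ : ‖x‖ < δ := by simpa using hx
    rw [(hf' x hx hx0).fderiv, norm_smul, norm_inv, norm_pow, norm_norm,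
      inv_mul_le_iff₀ (by positivity), mul_comm]
    exact hBle _ hs hsδ _ (hunit x hx0)
  · by_cases hx0 : x = 0
    · simp [hx0]
    have hs : 0 < ‖x‖ := norm_pos_iff.2 hx0
    have hsδ : ‖x‖ < δ := by simpa using hx
    rw [(hf x hx hx0).self_of_nhds.fderiv, hzero.fderiv]
    have hEq : ‖x‖⁻¹ • A ‖x‖ (‖x‖⁻¹ • x) - L = ‖x‖⁻¹ • (A ‖x‖ (‖x‖⁻¹ • x) - ‖x‖ • L) := by
      rw [smul_sub, inv_smul_smul₀ hs.ne']
    rw [hEq, norm_smul, norm_inv, norm_norm, inv_mul_le_iff₀ hs]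
    calc _ ≤ C * ‖x‖ ^ 2 := hAle _ hs hsδ _ (hunit x hx0)
      _ = _ := by ring

/-- The `C^{1,1}` estimate in an arbitrary finite-dimensional real inner product space. -/
theorem exists_lipschitz_fderiv_of_polar_smooth {E : Type*} [NormedAddCommGroup E]
    [InnerProductSpace ℝ E] [FiniteDimensional ℝ E] {ε : ℝ} (hε : 0 < ε)
    (f : E → ℝ → ℝ)
    (hf0 : ∀ t ∈ Set.Icc (0:ℝ) 1, f 0 t = 0)
    (V : Set (E × ℝ × ℝ)) (hVopen : IsOpen V)
    (hV : {p : E × ℝ × ℝ |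
        ‖p.1‖ = 1 ∧ p.2.1 ∈ Set.Ico (0:ℝ) ε ∧ p.2.2 ∈ Set.Icc (0:ℝ) 1} ⊆ V)
    (G : E × ℝ × ℝ → ℝ)
    (hG : ContDiffOn ℝ (⊤ : ℕ∞) G V)
    (hfG : ∀ ξ : E, ‖ξ‖ = 1 →
      ∀ r ∈ Set.Ico (0:ℝ) ε, ∀ t ∈ Set.Icc (0:ℝ) 1, f (r • ξ) t = G (ξ, r, t))
    (hlin : ∀ t ∈ Set.Icc (0:ℝ) 1,
      ∃ L : E →ₗ[ℝ] ℝ,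
        ∀ v : E, v ≠ 0 →
          L v = ‖v‖ * deriv (fun r => G (‖v‖⁻¹ • v, r, t)) 0) :
    ∃ δ : ℝ, 0 < δ ∧ δ < ε ∧ ∃ C : ℝ, 0 < C ∧
      ∀ t ∈ Set.Icc (0:ℝ) 1,
        (∀ x ∈ Metric.ball (0 : E) δ,
          DifferentiableAt ℝ (fun y => f y t) x) ∧
        (∀ x ∈ Metric.ball (0 : E) δ,
          ∀ y ∈ Metric.ball (0 : E) δ,
            ‖fderiv ℝ (fun z => f z t) x - fderiv ℝ (fun z => f z t) y‖ ≤
              C * ‖x - y‖) := by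
  -- the rescaled function `K (u, s, t) = f (s • u) t` and its domain of smoothness
  set φ : E × ℝ × ℝ → E × ℝ × ℝ := fun p => (‖p.1‖⁻¹ • p.1, p.2.1 * ‖p.1‖, p.2.2)
  set U : Set (E × ℝ × ℝ) := {p | p.1 ≠ 0}
  have hU : IsOpen U := isOpen_ne.preimage continuous_fst
  have hφ : ContDiffOn ℝ (⊤ : ℕ∞) φ U := by
    intro p hp
    have hnorm : ContDiffAt ℝ (⊤ : ℕ∞) (fun p : E × ℝ × ℝ => ‖p.1‖) p := contDiffAt_fst.norm ℝ hp
    exact (((hnorm.inv (norm_ne_zero_iff.2 hp)).smul contDiffAt_fst).prodMk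
      ((contDiffAt_snd.fst.mul hnorm).prodMk contDiffAt_snd.snd)).contDiffWithinAt
  set W : Set (E × ℝ × ℝ) := U ∩ φ ⁻¹' V
  have hW : IsOpen W := hφ.continuousOn.isOpen_inter_preimage hU hVopen
  set K : E × ℝ × ℝ → ℝ := fun p => G (φ p)
  have hK : ContDiffOn ℝ (⊤ : ℕ∞) K W := hG.comp (hφ.mono inter_subset_left) inter_subset_right
  have hA := contDiffOn_fderivFst hW hK
  have hB := contDiffOn_fderivFst hW hA
  set A := fderivFst K
  set B := fderivFst A
  have hunit : ∀ u : E, u ≠ 0 → ‖‖u‖⁻¹ • u‖ = 1 := fun u hu => by simp [norm_smul, hu]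
  have hmemW : ∀ u : E, u ≠ 0 → ∀ s : ℝ, 0 ≤ s → s * ‖u‖ < ε → ∀ t ∈ Icc (0 : ℝ) 1,
      (u, s, t) ∈ W := fun u hu s hs hsε t ht =>
    ⟨hu, hV ⟨hunit u hu, ⟨mul_nonneg hs (norm_nonneg u), hsε⟩, ht⟩⟩
  have hmemW0 : ∀ u : E, u ≠ 0 → ∀ t ∈ Icc (0 : ℝ) 1, (u, (0 : ℝ), t) ∈ W := fun u hu t ht =>
    hmemW u hu 0 le_rfl (by simpa using hε) t ht
  have hfK : ∀ u : E, u ≠ 0 → ∀ s : ℝ, 0 ≤ s → s * ‖u‖ < ε → ∀ t ∈ Icc (0 : ℝ) 1,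
      f (s • u) t = K (u, s, t) := fun u hu s hs hsε t ht => by
    have := hfG _ (hunit u hu) (s * ‖u‖) ⟨mul_nonneg hs (norm_nonneg u), hsε⟩ t ht
    rwa [smul_smul, mul_inv_cancel_right₀ (norm_ne_zero_iff.2 hu)] at this
  have hne : ∀ u : E, u ≠ 0 → ∀ᶠ v in 𝓝 u, v ≠ 0 := fun u hu => isOpen_ne.mem_nhds hu
  choose! L hL using hlin
  -- values and radial derivatives of `K`, `A`, `B` at `s = 0`
  have hK0 : ∀ t ∈ Icc (0 : ℝ) 1, ∀ u : E, u ≠ 0 → K (u, 0, t) = 0 := fun t ht u hu => by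
    rw [← hfK u hu 0 le_rfl (by simpa using hε) t ht, zero_smul, hf0 t ht]
  have hA0 : ∀ t ∈ Icc (0 : ℝ) 1, ∀ u : E, u ≠ 0 → A (u, 0, t) = 0 := fun t ht u hu =>
    (hasFDerivAt_fderivFst hW hK (hmemW0 u hu t ht)).unique
      ((hasFDerivAt_const (0 : ℝ) u).congr_of_eventuallyEq
        ((hne u hu).mono fun v hv => hK0 t ht v hv))
  have hB0 : ∀ t ∈ Icc (0 : ℝ) 1, ∀ u : E, u ≠ 0 → B (u, 0, t) = 0 := fun t ht u hu =>
    (hasFDerivAt_fderivFst hW hA (hmemW0 u hu t ht)).unique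
      ((hasFDerivAt_const (0 : E →L[ℝ] ℝ) u).congr_of_eventuallyEq
        ((hne u hu).mono fun v hv => hA0 t ht v hv))
  have hK1 : ∀ t ∈ Icc (0 : ℝ) 1, ∀ u : E, u ≠ 0 →
      fderiv ℝ K (u, 0, t) (0, 1, 0) = (L t).toContinuousLinearMap u := fun t ht u hu => by
    have hline : HasDerivAt (fun s : ℝ => (u, s, t)) ((0 : E), (1 : ℝ), (0 : ℝ)) 0 :=
      (hasDerivAt_const _ u).prodMk ((hasDerivAt_id _).prodMk (hasDerivAt_const _ t))
    have hd : DifferentiableAt ℝ K (u, 0, t) :=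
      (hK.contDiffAt (hW.mem_nhds (hmemW0 u hu t ht))).differentiableAt (by simp)
    have h1 : HasDerivAt (fun s : ℝ => K (u, s, t)) (fderiv ℝ K (u, 0, t) (0, 1, 0)) 0 :=
      HasFDerivAt.comp_hasDerivAt (l := K) 0 hd.hasFDerivAt hline
    have hKG : (fun s : ℝ => K (u, s, t)) = fun s => G (‖u‖⁻¹ • u, ‖u‖ * s, t) :=
      funext fun s => by rw [mul_comm]
    rw [← h1.deriv, hKG, deriv_comp_mul_left ‖u‖ (fun r => G (‖u‖⁻¹ • u, r, t)) 0]
    simp [hL t ht u hu]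
  have hA1 : ∀ t ∈ Icc (0 : ℝ) 1, ∀ u : E, u ≠ 0 →
      fderiv ℝ A (u, 0, t) (0, 1, 0) = (L t).toContinuousLinearMap := fun t ht u hu =>
    fderiv_fderivFst_apply hW hK (hmemW0 u hu t ht)
      ((hne u hu).mono fun v hv => hK1 t ht v hv) (ContinuousLinearMap.hasFDerivAt _)
  have hB1 : ∀ t ∈ Icc (0 : ℝ) 1, ∀ u : E, u ≠ 0 →
      fderiv ℝ B (u, 0, t) (0, 1, 0) = 0 := fun t ht u hu =>
    fderiv_fderivFst_apply hW hA (hmemW0 u hu t ht)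
      ((hne u hu).mono fun v hv => hA1 t ht v hv) (hasFDerivAt_const _ _)
  have hsphere : ∀ u : E, ‖u‖ = 1 → u ≠ 0 := fun u hu h => by simp [h] at hu
  have hcompact : IsCompact (Metric.sphere (0 : E) 1) := isCompact_sphere 0 1
  have hsub : Metric.sphere (0 : E) 1 ×ˢ Icc 0 (ε / 2) ×ˢ Icc (0 : ℝ) 1 ⊆ W := by
    rintro ⟨u, s, t⟩ ⟨hu, hs, ht⟩
    have hu' : ‖u‖ = 1 := by simpa using hu
    exact hmemW u (hsphere u hu') s hs.1 (by rw [hu', mul_one]; linarith [hs.2]) t ht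
  obtain ⟨C₀, hC₀, hKle⟩ := exists_norm_sub_sub_smul_le_sq hW hK hcompact isCompact_Icc hsub
  obtain ⟨C₁, hC₁, hAle⟩ := exists_norm_sub_sub_smul_le_sq hW hA hcompact isCompact_Icc hsub
  obtain ⟨C₂, hC₂, hBle⟩ := exists_norm_sub_sub_smul_le_sq hW hB hcompact isCompact_Icc hsub
  refine ⟨ε / 2, by linarith, by linarith, C₀ + C₁ + C₂ + 1, by linarith, fun t ht => ?_⟩
  have hlt : ∀ s, s < ε / 2 → ∀ u : E, ‖u‖ = 1 → ∀ᶠ v in 𝓝 u, v ≠ 0 ∧ s * ‖v‖ < ε :=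
    fun s hs u hu => (hne u (hsphere u hu)).and
      ((continuous_const.mul continuous_norm).continuousAt.eventually_lt continuousAt_const
        (by simp only [Pi.mul_apply, hu]; linarith))
  refine contDiff_one_one_of_rescaling (L := (L t).toContinuousLinearMap)
    (K := fun s u => K (u, s, t)) (A := fun s u => A (u, s, t)) (B := fun s u => B (u, s, t))
    (by linarith) (hf0 t ht) ?_ ?_ ?_ ?_ ?_ ?_ <;> intro s hs hsε u hu
  · filter_upwards [hlt s hsε u hu] with v hv using hfK v hv.1 s hs.le hv.2 t ht
  · filter_upwards [hlt s hsε u hu] with v hv using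
      hasFDerivAt_fderivFst hW hK (hmemW v hv.1 s hs.le hv.2 t ht)
  · obtain ⟨h1, h2⟩ := (hlt s hsε u hu).self_of_nhds
    exact hasFDerivAt_fderivFst hW hA (hmemW u h1 s hs.le h2 t ht)
  · have := hKle u (by simpa using hu) s ⟨hs.le, hsε.le⟩ t ht
    rw [hK0 t ht u (hsphere u hu), hK1 t ht u (hsphere u hu), sub_zero, smul_eq_mul] at this
    exact this.trans (by gcongr; linarith)
  · have := hAle u (by simpa using hu) s ⟨hs.le, hsε.le⟩ t ht
    rw [hA0 t ht u (hsphere u hu), hA1 t ht u (hsphere u hu), sub_zero] at this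
    exact this.trans (by gcongr; linarith)
  · have := hBle u (by simpa using hu) s ⟨hs.le, hsε.le⟩ t ht
    rw [hB0 t ht u (hsphere u hu), hB1 t ht u (hsphere u hu), sub_zero, smul_zero,
      sub_zero] at this
    exact this.trans (by gcongr; linarith)

/-- local model of C^{1,1} regularity of a cone-smooth family of
functions with linear cone-derivative. Let f : B(0,ε) × [0,1] → ℝ vanish at the
cone point, be given in polar coordinates by a function G that is C^∞ on an open
set V containing S^{n-1} × [0,ε) × [0,1], and suppose for each t the degree-1
homogeneous function v ↦ ‖v‖·(∂G/∂r)(v/‖v‖,0,t) (extended by 0 at 0) is linear.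
Then there are δ ∈ (0,ε) and C > 0 such that, for every t ∈ [0,1], x ↦ f(x,t)
is differentiable on B(0,δ) with derivative Lipschitz of constant at most C. -/
theorem cone_smooth_linear_is_C11 (n : ℕ) (hn : 1 ≤ n) (ε : ℝ) (hε : 0 < ε)
    (f : EuclideanSpace ℝ (Fin n) → ℝ → ℝ)
    (hf0 : ∀ t ∈ Set.Icc (0:ℝ) 1, f 0 t = 0)
    (V : Set (EuclideanSpace ℝ (Fin n) × ℝ × ℝ)) (hVopen : IsOpen V)
    (hV : {p : EuclideanSpace ℝ (Fin n) × ℝ × ℝ |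
        ‖p.1‖ = 1 ∧ p.2.1 ∈ Set.Ico (0:ℝ) ε ∧ p.2.2 ∈ Set.Icc (0:ℝ) 1} ⊆ V)
    (G : EuclideanSpace ℝ (Fin n) × ℝ × ℝ → ℝ)
    (hG : ContDiffOn ℝ (⊤ : ℕ∞) G V)
    (hfG : ∀ ξ : EuclideanSpace ℝ (Fin n), ‖ξ‖ = 1 →
      ∀ r ∈ Set.Ico (0:ℝ) ε, ∀ t ∈ Set.Icc (0:ℝ) 1, f (r • ξ) t = G (ξ, r, t))
    (hlin : ∀ t ∈ Set.Icc (0:ℝ) 1,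
      ∃ L : EuclideanSpace ℝ (Fin n) →ₗ[ℝ] ℝ,
        ∀ v : EuclideanSpace ℝ (Fin n), v ≠ 0 →
          L v = ‖v‖ * deriv (fun r => G (‖v‖⁻¹ • v, r, t)) 0) :
    ∃ δ : ℝ, 0 < δ ∧ δ < ε ∧ ∃ C : ℝ, 0 < C ∧
      ∀ t ∈ Set.Icc (0:ℝ) 1,
        (∀ x ∈ Metric.ball (0 : EuclideanSpace ℝ (Fin n)) δ,
          DifferentiableAt ℝ (fun y => f y t) x) ∧
        (∀ x ∈ Metric.ball (0 : EuclideanSpace ℝ (Fin n)) δ,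
          ∀ y ∈ Metric.ball (0 : EuclideanSpace ℝ (Fin n)) δ,
            ‖fderiv ℝ (fun z => f z t) x - fderiv ℝ (fun z => f z t) y‖ ≤
              C * ‖x - y‖) := by
  exact exists_lipschitz_fderiv_of_polar_smooth hε f hf0 V hVopen hV G hG hfG hlin
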